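/- Let a ∈ K_n, a ≠ 0, with |a|_n = q_n^N (N ∈ ℤ), and let e_n be the ramification index of K_n/k. Then the μ-essential supremum over x ∈ K̄ of |⟨a,x⟩|₁ equals q₁^{−⌊−N/e_n⌋}, where ⌊·⌋ denotes the floor function. -/

import Mathlib

open MeasureTheory Module
open scoped Classical

noncomputable section

/-- The topology defined by a translation-invariant "norm" function via open balls. -/
def normTopology {X : Type} [Sub X] (f : X → ℝ) : TopologicalSpace X :=
  TopologicalSpace.generateFrom
    {U | ∃ x : X, ∃ ε : ℝ, 0 < ε ∧ U = {y : X | f (y - x) < ε}}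

variable (p : ℕ) [Fact (Nat.Prime p)]
variable (k : Type) [Field k] [Algebra ℚ_[p] k] [FiniteDimensional ℚ_[p] k]

/-- The normalized absolute value on the local field k. -/
def absk (x : k) : ℝ := ‖(Algebra.norm ℚ_[p] x : ℚ_[p])‖

/-- The topology of k as a local field. -/
def kTop : TopologicalSpace k := normTopology (absk p k)

variable (K : Type) [Field K] [Algebra k K] [CharZero K]
variable (Kn : ℕ → IntermediateField k K)

/-- The relative trace map between two intermediate fields. -/
def relTrace (E F : IntermediateField k K) (h : E ≤ F) (x : F) : E :=
  (@Algebra.trace E F _ _ (IntermediateField.inclusion h).toRingHom.toAlgebra) x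

variable (T : ℕ → K →ₗ[k] K)

/-- The projective limit K̄ of the fields Kₙ along the normalized trace maps. -/
def ProjLim : Type :=
  {x : ℕ → K // (∀ n, x n ∈ Kn n) ∧ ∀ ⦃n ν : ℕ⦄, n ≤ ν → T n (x ν) = x n}

/-- Pointwise addition on K̄. -/
def pladd (x y : ProjLim k K Kn T) : ProjLim k K Kn T :=
  ⟨fun n => x.1 n + y.1 n, by
    refine ⟨fun n => add_mem (x.2.1 n) (y.2.1 n), ?_⟩
    intro n ν h
    simp [map_add, x.2.2 h, y.2.2 h]⟩

/-- Pointwise scalar multiplication on K̄. -/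
def plsmul (c : k) (x : ProjLim k K Kn T) : ProjLim k K Kn T :=
  ⟨fun n => c • x.1 n, by
    refine ⟨fun n => (Kn n).toSubalgebra.smul_mem (x.2.1 n) c, ?_⟩
    intro n ν h
    simp [_root_.map_smul, x.2.2 h]⟩

/-- The topology on K̄ given by the seminorms x ↦ ‖xₙ‖. -/
def projTop (Knorm : K → ℝ) : TopologicalSpace (ProjLim k K Kn T) :=
  TopologicalSpace.generateFrom
    {U | ∃ x : ProjLim k K Kn T, ∃ n : ℕ, ∃ ε : ℝ, 0 < ε ∧
          U = {y : ProjLim k K Kn T | Knorm (y.1 n - x.1 n) < ε}}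

/-- The Borel σ-algebra of the seminorm topology on K̄. -/
def projMeas (Knorm : K → ℝ) : MeasurableSpace (ProjLim k K Kn T) :=
  @borel _ (projTop k K Kn T Knorm)

/-- The topology on Kₙ induced from the absolute value ‖·‖. -/
def KnTop (Knorm : K → ℝ) (n : ℕ) : TopologicalSpace (Kn n) :=
  TopologicalSpace.induced Subtype.val (normTopology Knorm)

/-- The Borel σ-algebra of Kₙ. -/
def KnMeas (Knorm : K → ℝ) (n : ℕ) : MeasurableSpace (Kn n) :=
  @borel _ (KnTop k K Kn Knorm n)

/-- The canonical embedding of K into K̄. -/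
def emb (hTmem : ∀ n x, T n x ∈ Kn n)
    (hTproj : ∀ ⦃n ν : ℕ⦄, n ≤ ν → ∀ x : K, T n (T ν x) = T n x) (x : K) :
    ProjLim k K Kn T :=
  ⟨fun n => T n x, fun n => hTmem n x, fun n ν h => hTproj h x⟩

/-- The weak topology σ(K̄, K) on K̄. -/
def weakTop (pairing : K → ProjLim k K Kn T → k) : TopologicalSpace (ProjLim k K Kn T) :=
  ⨅ a : K, TopologicalSpace.induced (pairing a) (kTop p k)

/-- Non-archimedean seminorms on K over k. -/
def IsNASeminorm (f : K → ℝ) : Prop :=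
  (∀ x, 0 ≤ f x) ∧ (∀ x y, f (x + y) ≤ max (f x) (f y)) ∧
    ∀ (c : k) (x : K), f (c • x) = absk p k c * f x

/-- The locally convex topology determined by a family of seminorms. -/
def seminormFamilyTop (F : Set (K → ℝ)) : TopologicalSpace K :=
  TopologicalSpace.generateFrom
    {U | ∃ f ∈ F, ∃ x : K, ∃ ε : ℝ, 0 < ε ∧ U = {y : K | f (y - x) < ε}}

/-- The inductive limit topology on K: the finest locally convex topology over k
making all the inclusions Kₙ → K continuous. -/
def indTop (Knorm : K → ℝ) : TopologicalSpace K :=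
  sInf {t : TopologicalSpace K |
    (∃ F : Set (K → ℝ), (∀ f ∈ F, IsNASeminorm p k K f) ∧ t = seminormFamilyTop K F) ∧
    ∀ n : ℕ, @Continuous _ _ (KnTop k K Kn Knorm n) t Subtype.val}

/-- Locally constant functions with bounded (hence compact) support on Kₙ. -/
def IsTestFun (Knorm : K → ℝ) (n : ℕ) (φ : Kn n → ℂ) : Prop :=
  @IsLocallyConstant _ _ (KnTop k K Kn Knorm n) φ ∧
    ∃ R : ℝ, ∀ ξ : Kn n, R < Knorm ↑ξ → φ ξ = 0


/-- The fractional differentiation operator Dᵅ applied to the cylindrical function φ ∘ Tₙ. -/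
def Dop (Knorm : K → ℝ) (χ : k → ℂ) (pairing : K → ProjLim k K Kn T → k)
    (vol : ∀ n : ℕ, @MeasureTheory.Measure (Kn n) (KnMeas k K Kn Knorm n))
    (μ : @MeasureTheory.Measure (ProjLim k K Kn T) (projMeas k K Kn T Knorm))
    (α : ℝ) (n : ℕ) (φ : Kn n → ℂ) (x : ProjLim k K Kn T) : ℂ :=
  ∫ ξ : Kn n,
    χ ((finrank k (Kn n) : k)⁻¹ *
        Algebra.trace k (Kn n) (-(⟨x.1 n, x.2.1 n⟩ * ξ))) *
      (if 1 < Knorm ↑ξ then ((Knorm ↑ξ ^ α : ℝ) : ℂ) else 0) *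
      (∫ y, χ (pairing (↑ξ) y) * φ ⟨y.1 n, y.2.1 n⟩ ∂μ) ∂(vol n)
end

section AbsoluteValue

variable (p : ℕ) [Fact (Nat.Prime p)]
variable (k : Type) [Field k] [Algebra ℚ_[p] k]

lemma absk_nonneg (x : k) : 0 ≤ absk p k x := norm_nonneg _

lemma absk_mul (x y : k) : absk p k (x * y) = absk p k x * absk p k y := by
  simp [absk]

lemma absk_pow (x : k) (n : ℕ) : absk p k (x ^ n) = absk p k x ^ n := by
  simp [absk]

variable [FiniteDimensional ℚ_[p] k]

lemma absk_zero : absk p k 0 = 0 := by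
  simp [absk, Algebra.norm_zero]

lemma absk_inv (x : k) : absk p k x⁻¹ = (absk p k x)⁻¹ := by
  rcases eq_or_ne x 0 with rfl | hx
  · simp [absk_zero]
  · refine eq_inv_of_mul_eq_one_left ?_
    rw [← absk_mul, inv_mul_cancel₀ hx]
    simp [absk]

lemma absk_zpow (x : k) (n : ℤ) : absk p k (x ^ n) = absk p k x ^ n := by
  cases n with
  | ofNat n => simpa using absk_pow p k x n
  | negSucc n => simp only [zpow_negSucc, absk_inv, absk_pow]

lemma absk_pos {x : k} (hx : x ≠ 0) : 0 < absk p k x := by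
  simpa [absk, Algebra.norm_eq_zero_iff] using hx

lemma absk_eq_spectralNorm_pow (x : k) :
    absk p k x = spectralNorm ℚ_[p] k x ^ finrank ℚ_[p] k := by
  have hx : IsIntegral ℚ_[p] x := Algebra.IsIntegral.isIntegral x
  have hs : spectralNorm ℚ_[p] k x ^ (minpoly ℚ_[p] x).natDegree =
      ‖(minpoly ℚ_[p] x).coeff 0‖ := by
    rw [spectralNorm.spectralNorm_eq_norm_coeff_zero_rpow, ← Real.rpow_natCast,
      ← Real.rpow_mul (norm_nonneg _), one_div, inv_mul_cancel₀, Real.rpow_one]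
    exact_mod_cast (minpoly.natDegree_pos hx).ne'
  have hg : ‖Algebra.norm ℚ_[p] (IntermediateField.AdjoinSimple.gen ℚ_[p] x)‖ =
      ‖(minpoly ℚ_[p] x).coeff 0‖ := by
    have h := Algebra.PowerBasis.norm_gen_eq_coeff_zero_minpoly
      (IntermediateField.adjoin.powerBasis hx)
    rw [IntermediateField.adjoin.powerBasis_gen, IntermediateField.minpoly_gen] at h
    rw [h, norm_mul, norm_pow, norm_neg, norm_one, one_pow, one_mul]
  rw [absk, Algebra.norm_eq_norm_adjoin, norm_pow, hg, ← hs, ← pow_mul,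
    ← IntermediateField.adjoin.finrank hx, Module.finrank_mul_finrank]

lemma absk_add_le_max (x y : k) : absk p k (x + y) ≤ max (absk p k x) (absk p k y) := by
  have h : spectralNorm ℚ_[p] k (x + y) ≤
      max (spectralNorm ℚ_[p] k x) (spectralNorm ℚ_[p] k y) := isNonarchimedean_spectralNorm x y
  simp only [absk_eq_spectralNorm_pow]
  rcases le_max_iff.1 h with h | h
  · exact le_max_of_le_left (pow_le_pow_left₀ (spectralNorm_nonneg _) h _)
  · exact le_max_of_le_right (pow_le_pow_left₀ (spectralNorm_nonneg _) h _)

lemma exists_absk_mem_Ioo : ∃ c : k, 0 < absk p k c ∧ absk p k c < 1 := by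
  refine ⟨algebraMap ℚ_[p] k p, ?_⟩
  have hp : (0 : ℝ) < ‖(p : ℚ_[p])‖ := by
    simpa using (Fact.out : p.Prime).pos
  rw [absk, Algebra.norm_algebraMap, norm_pow]
  exact ⟨pow_pos hp _, pow_lt_one₀ hp.le Padic.norm_p_lt_one Module.finrank_pos.ne'⟩

lemma exists_countable_absk_dense :
    ∃ D : Set k, D.Countable ∧ ∀ x : k, ∀ ε : ℝ, 0 < ε → ∃ d ∈ D, absk p k (d - x) < ε := by
  let : NormedField k := spectralNorm.normedField ℚ_[p] k
  let : NormedSpace ℚ_[p] k := spectralNorm.normedSpace ℚ_[p] k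
  have : ProperSpace k := FiniteDimensional.proper ℚ_[p] k
  obtain ⟨D, hDc, hD⟩ := TopologicalSpace.exists_countable_dense k
  refine ⟨D, hDc, fun x ε hε ↦ ?_⟩
  obtain ⟨d, hd, hlt⟩ := hD.exists_dist_lt x (lt_min hε one_pos)
  refine ⟨d, hd, ?_⟩
  have hlt' : spectralNorm ℚ_[p] k (d - x) < min ε 1 := by
    rw [dist_comm] at hlt
    exact hlt
  rw [absk_eq_spectralNorm_pow]
  calc _ ≤ spectralNorm ℚ_[p] k (d - x) :=
        pow_le_of_le_one (spectralNorm_nonneg _) (hlt'.le.trans (min_le_right _ _))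
          Module.finrank_pos.ne'
    _ < ε := hlt'.trans_le (min_le_left _ _)

variable {p k}

/-- If `Q⁻¹` is the greatest value below `1`, the value group is generated by `Q`. -/
lemma absk_eq_zpow_of_isGreatest {Q : ℝ}
    (hQ : IsGreatest {r : ℝ | (∃ c : k, absk p k c = r) ∧ r < 1} Q⁻¹) :
    1 < Q ∧ (∀ j : ℤ, ∃ c : k, absk p k c = Q ^ j) ∧
      ∀ c : k, c ≠ 0 → ∃ j : ℤ, absk p k c = Q ^ j := by
  obtain ⟨⟨⟨π, hπ⟩, hlt⟩, hmax⟩ := hQ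
  have hpos : 0 < Q⁻¹ := by
    obtain ⟨c, hc0, hc1⟩ := exists_absk_mem_Ioo p k
    exact hc0.trans_le (hmax ⟨⟨c, rfl⟩, hc1⟩)
  have hQ0 : 0 < Q := inv_pos.1 hpos
  have hQ1 : 1 < Q := (inv_lt_one₀ hQ0).1 hlt
  have hval (j : ℤ) : absk p k (π ^ j) = Q ^ (-j) := by
    rw [absk_zpow, hπ, inv_zpow, zpow_neg]
  refine ⟨hQ1, fun j ↦ ⟨π ^ (-j), by rw [hval, neg_neg]⟩, fun c hc ↦ ?_⟩
  obtain ⟨j, hj1, hj2⟩ := exists_mem_Ico_zpow (absk_pos p k hc) hQ1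
  refine ⟨j, le_antisymm ?_ hj1⟩
  have hlt1 : absk p k (c * π ^ (j + 1)) < 1 := by
    rw [absk_mul, hval, zpow_neg, ← div_eq_mul_inv, div_lt_one (zpow_pos hQ0 _)]
    exact hj2
  have h := hmax ⟨⟨_, rfl⟩, hlt1⟩
  rw [absk_mul, hval, zpow_neg, ← div_eq_mul_inv, div_le_iff₀ (zpow_pos hQ0 _),
    zpow_add_one₀ hQ0.ne'] at h
  calc absk p k c ≤ Q⁻¹ * (Q ^ j * Q) := h
    _ = Q ^ j := by field_simp

end AbsoluteValue

lemma ae_eq_one_of_integral_eq_one {X : Type*} [MeasurableSpace X] {μ : Measure X}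
    [IsProbabilityMeasure μ] {g : X → ℂ} (hg : ∀ x, ‖g x‖ = 1) (hint : ∫ x, g x ∂μ = 1) :
    ∀ᵐ x ∂μ, g x = 1 := by
  have hi : Integrable g μ := by
    by_contra h
    rw [integral_undef h] at hint
    exact zero_ne_one hint
  have hir : Integrable (fun x ↦ (g x).re) μ := hi.re
  have hre : ∫ x, (g x).re ∂μ = 1 := by
    have h := integral_re hi
    simpa [hint] using h
  have hle (x : X) : (g x).re ≤ 1 := (Complex.re_le_norm _).trans (hg x).le
  have hz : ∫ x, (1 - (g x).re) ∂μ = 0 := by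
    rw [integral_sub (integrable_const _) hir]
    simp [hre]
  have h0 := (integral_eq_zero_iff_of_nonneg (fun x ↦ sub_nonneg.2 (hle x))
    ((integrable_const (1 : ℝ)).sub hir)).1 hz
  filter_upwards [h0] with x hx
  have hx1 : (g x).re = 1 := by
    have : 1 - (g x).re = 0 := hx
    linarith
  have hn : ‖g x‖ ^ 2 = 1 := by rw [hg, one_pow]
  rw [Complex.sq_norm, Complex.normSq_apply, hx1] at hn
  have him : (g x).im = 0 := by nlinarith
  exact Complex.ext hx1 him

/-- A random variable whose characteristic function is the indicator of the ball of radius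
`Q ^ M` is bounded by `Q ^ (-M)`, and this bound is optimal. -/
lemma essSup_absk_eq {p : ℕ} [Fact (Nat.Prime p)] {k : Type} [Field k] [Algebra ℚ_[p] k]
    [FiniteDimensional ℚ_[p] k] {Q : ℝ}
    (hQ : IsGreatest {r : ℝ | (∃ c : k, absk p k c = r) ∧ r < 1} Q⁻¹)
    {χ : k → ℂ} (hadd : ∀ x y : k, χ (x + y) = χ x * χ y) (hnorm : ∀ x : k, ‖χ x‖ = 1)
    (htriv : ∀ x : k, absk p k x ≤ 1 → χ x = 1)
    (hrank : ∃ x : k, absk p k x ≤ Q ∧ χ x ≠ 1)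
    {X : Type*} [MeasurableSpace X] {μ : Measure X} [IsProbabilityMeasure μ]
    (Y : X → k) (M : ℤ)
    (hchar : ∀ c : k, c ≠ 0 →
      ∫ x, χ (c * Y x) ∂μ = if absk p k c ≤ Q ^ M then (1 : ℂ) else 0) :
    essSup (fun x ↦ absk p k (Y x)) μ = Q ^ (-M) := by
  obtain ⟨hQ1, hsurj, hval⟩ := absk_eq_zpow_of_isGreatest hQ
  have hQ0 : 0 < Q := one_pos.trans hQ1
  have hupper : ∀ᵐ x ∂μ, absk p k (Y x) ≤ Q ^ (-M) := by
    obtain ⟨D, hDc, hD⟩ := exists_countable_absk_dense p k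
    have hae : ∀ᵐ x ∂μ, ∀ d ∈ D, d ≠ 0 → absk p k d ≤ Q ^ M → χ (d * Y x) = 1 := by
      refine (ae_ball_iff hDc).2 fun d _ ↦ ?_
      by_cases h : d ≠ 0 ∧ absk p k d ≤ Q ^ M
      · filter_upwards [ae_eq_one_of_integral_eq_one (fun x ↦ hnorm (d * Y x))
          (by rw [hchar d h.1, if_pos h.2])] with x hx _ _ using hx
      · exact .of_forall fun x h1 h2 ↦ (h ⟨h1, h2⟩).elim
    filter_upwards [hae] with x hx
    by_contra! hlt
    obtain ⟨b, hbQ, hb1⟩ := hrank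
    have hY0 : Y x ≠ 0 := by
      intro h0
      rw [h0] at hlt
      exact (zpow_pos hQ0 _).not_gt (by simpa [absk_zero] using hlt)
    obtain ⟨j, hj⟩ := hval _ hY0
    have hb0 : b ≠ 0 := by
      rintro rfl
      exact hb1 (htriv 0 (by simp [absk_zero]))
    have hYpos := absk_pos p k hY0
    have hjM : -M + 1 ≤ j := by
      rw [hj] at hlt
      exact (zpow_lt_zpow_iff_right₀ hQ1).1 hlt
    have hc : absk p k (b / Y x) ≤ Q ^ M := by
      rw [div_eq_mul_inv, absk_mul, absk_inv, ← div_eq_mul_inv, div_le_iff₀ hYpos, hj,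
        ← zpow_add₀ hQ0.ne']
      calc absk p k b ≤ Q ^ (1 : ℤ) := by simpa using hbQ
        _ ≤ Q ^ (M + j) := zpow_le_zpow_right₀ hQ1.le (by linarith)
    obtain ⟨d, hdD, hd⟩ := hD (b / Y x) (min (absk p k (Y x))⁻¹ (Q ^ M))
      (lt_min (inv_pos.2 hYpos) (zpow_pos hQ0 _))
    have hd1 : χ ((d - b / Y x) * Y x) = 1 := by
      refine htriv _ ?_
      rw [absk_mul, ← le_div_iff₀ hYpos, one_div]
      exact hd.le.trans (min_le_left _ _)
    have hdb : χ (d * Y x) = χ b := by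
      have : d * Y x = (d - b / Y x) * Y x + b := by field_simp; ring
      rw [this, hadd, hd1, one_mul]
    refine hb1 (hdb ▸ hx d hdD ?_ ?_)
    · rintro rfl
      rw [zero_mul, htriv 0 (by simp [absk_zero])] at hdb
      exact hb1 hdb.symm
    · have h := absk_add_le_max p k (d - b / Y x) (b / Y x)
      rw [sub_add_cancel] at h
      exact h.trans (max_le (hd.le.trans (min_le_right _ _)) hc)
  have hlower : ∀ r : ℝ, (∀ᵐ x ∂μ, absk p k (Y x) ≤ r) → Q ^ (-M) ≤ r := by
    intro r hr
    by_contra! hlt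
    obtain ⟨c, hc⟩ := hsurj (M + 1)
    have hc0 : c ≠ 0 := by
      rintro rfl
      exact (zpow_pos hQ0 (M + 1)).ne (by simpa [absk_zero] using hc)
    have hone : ∀ᵐ x ∂μ, χ (c * Y x) = 1 := by
      filter_upwards [hr] with x hx
      refine htriv _ ?_
      by_cases hY : Y x = 0
      · simp [hY, absk_zero]
      obtain ⟨j, hj⟩ := hval _ hY
      have hj' : j < -M := by
        rw [hj] at hx
        exact (zpow_lt_zpow_iff_right₀ hQ1).1 (hx.trans_lt hlt)
      rw [absk_mul, hc, hj, ← zpow_add₀ hQ0.ne']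
      exact zpow_le_one_of_nonpos₀ hQ1.le (by linarith)
    have h := hchar c hc0
    rw [integral_congr_ae hone, hc, if_neg] at h
    · simp at h
    · exact not_le.2 (zpow_lt_zpow_right₀ hQ1 (by linarith))
  have hleast : IsLeast {r : ℝ | ∀ᵐ x ∂μ, absk p k (Y x) ≤ r} (Q ^ (-M)) := ⟨hupper, hlower⟩
  exact hleast.csInf_eq

theorem statement_12
    (p : ℕ) [Fact (Nat.Prime p)]
    (k : Type) [Field k] [Algebra ℚ_[p] k] [FiniteDimensional ℚ_[p] k]
    (K : Type) [Field K] [Algebra k K] [CharZero K]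
    (Kn : ℕ → IntermediateField k K)
    (hbot : Kn 1 = ⊥) (hmono : Monotone Kn)
    [hfd : ∀ n, FiniteDimensional k (Kn n)]
    (hunion : ∀ x : K, ∃ n, x ∈ Kn n)
    (T : ℕ → K →ₗ[k] K)
    (hTmem : ∀ (n : ℕ) (x : K), T n x ∈ Kn n)
    (hTdef : ∀ (n ν : ℕ) (h : n ≤ ν) (x : K) (hx : x ∈ Kn ν),
      T n x = ((finrank k (Kn n) : K) / (finrank k (Kn ν) : K)) *
        (relTrace k K (Kn n) (Kn ν) (hmono h) ⟨x, hx⟩ : K))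
    (Knorm : K → ℝ)
    (hKnorm : ∀ (n : ℕ) (x : K) (hx : x ∈ Kn n),
      Knorm x = absk p k (Algebra.norm k (⟨x, hx⟩ : Kn n)) ^ ((finrank k (Kn n) : ℝ)⁻¹))
    (pairing : K → ProjLim k K Kn T → k)
    (hpair : ∀ (n : ℕ) (a : K) (ha : a ∈ Kn n) (x : ProjLim k K Kn T),
      pairing a x = (finrank k (Kn n) : k)⁻¹ *
        Algebra.trace k (Kn n) (⟨a * x.1 n, mul_mem ha (x.2.1 n)⟩ : Kn n))
    (q : ℕ → ℕ)
    (hq : ∀ n : ℕ, IsGreatest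
      {r : ℝ | (∃ x : Kn n, Knorm ↑x ^ (finrank k (Kn n) : ℝ) = r) ∧ r < 1} ((q n : ℝ)⁻¹))
    (χ : k → ℂ)
    (hχadd : ∀ x y : k, χ (x + y) = χ x * χ y)
    (hχnorm : ∀ x : k, ‖χ x‖ = 1)
    (hχcont : @Continuous _ _ (kTop p k) _ χ)
    (hχtriv : ∀ x : k, absk p k x ≤ 1 → χ x = 1)
    (hχrank : ∃ x : k, absk p k x ≤ (q 1 : ℝ) ∧ χ x ≠ 1)
    (μ : @MeasureTheory.Measure (ProjLim k K Kn T) (projMeas k K Kn T Knorm))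
    (hμprob : MeasureTheory.IsProbabilityMeasure μ)
    (hμradon : ∀ A : Set (ProjLim k K Kn T), MeasurableSet[projMeas k K Kn T Knorm] A →
      μ A = ⨆ (C : Set (ProjLim k K Kn T))
        (_ : C ⊆ A ∧ @IsCompact _ (projTop k K Kn T Knorm) C), μ C)
    (hμchar : ∀ a : K, ∫ x, χ (pairing a x) ∂μ = if Knorm a ≤ 1 then (1 : ℂ) else 0)
    (e f : ℕ → ℕ)
    (hef : ∀ n : ℕ, q n = q 1 ^ f n ∧ finrank k (Kn n) = e n * f n)
    (n : ℕ) (hn : 1 ≤ n) (a : K) (ha : a ∈ Kn n) (ha0 : a ≠ 0) (N : ℤ)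
    (hN : Knorm a ^ (finrank k (Kn n) : ℝ) = (q n : ℝ) ^ N) :
    essSup (fun x : ProjLim k K Kn T => absk p k (pairing a x)) μ =
      (q 1 : ℝ) ^ (-⌊(-(N : ℝ)) / (e n : ℝ)⌋) := by
  let _ : MeasurableSpace (ProjLim k K Kn T) := projMeas k K Kn T Knorm
  have : IsProbabilityMeasure μ := hμprob
  have hone : finrank k (Kn 1) = 1 := by
    rw [hbot]
    exact IntermediateField.finrank_bot
  have hQ : IsGreatest {r : ℝ | (∃ c : k, absk p k c = r) ∧ r < 1} ((q 1 : ℝ)⁻¹) := by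
    convert hq 1 using 1
    ext r
    refine and_congr_left fun _ ↦ ?_
    have hKnorm1 (y : Kn 1) :
        Knorm y ^ (finrank k (Kn 1) : ℝ) = absk p k (Algebra.norm k y) := by
      rw [hKnorm 1 y y.2, hone]
      simp
    simp only [hKnorm1]
    constructor
    · rintro ⟨c, hc⟩
      refine ⟨algebraMap k (Kn 1) c, ?_⟩
      rw [Algebra.norm_algebraMap, hone, pow_one, hc]
    · rintro ⟨y, hy⟩
      exact ⟨_, hy⟩
  obtain ⟨hQ1, -, hval⟩ := absk_eq_zpow_of_isGreatest hQ
  have hQ0 : 0 < (q 1 : ℝ) := one_pos.trans hQ1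
  have hm : 0 < finrank k (Kn n) := finrank_pos
  have hm' : (finrank k (Kn n) : ℝ) ≠ 0 := by exact_mod_cast hm.ne'
  have hsmul (c : k) : Knorm (c • a) = absk p k c * Knorm a := by
    have hca : c • a ∈ Kn n := (Kn n).smul_mem ha
    rw [hKnorm n _ hca, hKnorm n a ha]
    have heq : (⟨c • a, hca⟩ : Kn n) = algebraMap k (Kn n) c * ⟨a, ha⟩ := by
      rw [← Algebra.smul_def]
      rfl
    rw [heq, map_mul, Algebra.norm_algebraMap, absk_mul, absk_pow,
      Real.mul_rpow (pow_nonneg (absk_nonneg _ _ _) _) (absk_nonneg _ _ _),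
      Real.pow_rpow_inv_natCast (absk_nonneg _ _ _) hm.ne']
  have hpairsmul (c : k) (x : ProjLim k K Kn T) : pairing (c • a) x = c * pairing a x := by
    have hca : c • a ∈ Kn n := (Kn n).smul_mem ha
    rw [hpair n _ hca, hpair n a ha]
    have heq : (⟨c • a * x.1 n, mul_mem hca (x.2.1 n)⟩ : Kn n) =
        c • ⟨a * x.1 n, mul_mem ha (x.2.1 n)⟩ := Subtype.ext (smul_mul_assoc _ _ _)
    rw [heq, map_smul, smul_eq_mul]
    ring
  obtain ⟨hqf, hmef⟩ := hef n
  have he : (e n : ℝ) ≠ 0 := by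
    intro h
    rw [hmef, Nat.cast_mul, h, zero_mul] at hm'
    exact hm' rfl
  have hf : (f n : ℝ) ≠ 0 := by
    intro h
    rw [hmef, Nat.cast_mul, h, mul_zero] at hm'
    exact hm' rfl
  have hKa0 : 0 ≤ Knorm a := by
    rw [hKnorm n a ha]
    exact Real.rpow_nonneg (absk_nonneg _ _ _) _
  have hKa : Knorm a = (q 1 : ℝ) ^ ((N : ℝ) / (e n : ℝ)) := by
    rw [← Real.rpow_rpow_inv hKa0 hm', hN, hqf, hmef, ← Real.rpow_intCast, Nat.cast_pow,
      ← Real.rpow_natCast, ← Real.rpow_mul hQ0.le, ← Real.rpow_mul hQ0.le]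
    congr 1
    push_cast
    field_simp
  refine essSup_absk_eq hQ hχadd hχnorm hχtriv hχrank (pairing a) _ fun c hc ↦ ?_
  simp only [← hpairsmul]
  rw [hμchar]
  obtain ⟨j, hj⟩ := hval c hc
  congr 1
  rw [hsmul, hj, hKa, zpow_le_zpow_iff_right₀ hQ1, ← Real.rpow_intCast, ← Real.rpow_add hQ0,
    Real.rpow_le_one_iff_of_pos hQ0, Int.le_floor, neg_div]
  refine propext ⟨?_, fun h ↦ Or.inl ⟨hQ1.le, by linarith⟩⟩
  rintro (h | h)
  · linarith [h.2]
  · linarith [h.1]
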